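/- Let d ≥ 1, let μ ∈ P_1(ℝ^d) be centered, and let ρ_n ∈ P_1(ℝ^d) be centered probability measures converging weakly to a probability measure ρ ∈ P_1(ℝ^d). Then liminf_n T(ρ_n,μ) ≥ T(ρ,μ) (as elements of [0,+∞]). -/

import Mathlib

open MeasureTheory Real Filter Topology
open scoped ENNReal RealInnerProductSpace

noncomputable section

/-- `d`-dimensional Euclidean space. -/
abbrev Ed (d : ℕ) := EuclideanSpace ℝ (Fin d)

open Classical in
/-- The entropy `E(ρ) = ∫ f ln f dx` (extended-real-valued, computed as positive part minus
negative part of the integral of `f ln f`, where `f` is the density), and `+∞` if `ρ` is not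
absolutely continuous w.r.t. Lebesgue measure. -/
def entropy {d : ℕ} (ρ : Measure (Ed d)) : EReal :=
  if ρ ≪ (volume : Measure (Ed d)) then
    ((∫⁻ x, ENNReal.ofReal ((ρ.rnDeriv volume x).toReal *
        Real.log (ρ.rnDeriv volume x).toReal) : ℝ≥0∞) : EReal)
      - ((∫⁻ x, ENNReal.ofReal (-((ρ.rnDeriv volume x).toReal *
        Real.log (ρ.rnDeriv volume x).toReal)) : ℝ≥0∞) : EReal)
  else ⊤

/-- The (extended-real-valued) integral `∫ ⟨x,y⟩ dγ(x,y)`: positive part minus negative part. -/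
def pairInt {d : ℕ} (γ : Measure (Ed d × Ed d)) : EReal :=
  ((∫⁻ p, ENNReal.ofReal (⟪p.1, p.2⟫ : ℝ) ∂γ : ℝ≥0∞) : EReal)
    - ((∫⁻ p, ENNReal.ofReal (-(⟪p.1, p.2⟫ : ℝ)) ∂γ : ℝ≥0∞) : EReal)

/-- Transport plans: probability measures on the product with marginals `ρ` and `μ`. -/
def Couplings {d : ℕ} (ρ μ : Measure (Ed d)) : Set (Measure (Ed d × Ed d)) :=
  {γ | IsProbabilityMeasure γ ∧ γ.fst = ρ ∧ γ.snd = μ}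

/-- The maximal correlation functional `T(ρ,μ) = sup { ∫⟨x,y⟩ dγ : γ ∈ Π(ρ,μ) }`. -/
def maxCorr {d : ℕ} (ρ μ : Measure (Ed d)) : EReal :=
  ⨆ γ ∈ Couplings ρ μ, pairInt γ

/-- `ρ` has finite first moment. -/
def FirstMoment {d : ℕ} (ρ : Measure (Ed d)) : Prop := Integrable (fun x => ‖x‖) ρ

/-- `ρ` is centered: its barycenter is `0`. -/
def Centered {d : ℕ} (ρ : Measure (Ed d)) : Prop := (∫ x, x ∂ρ) = 0

/-- Weak convergence of measures: convergence of integrals of bounded continuous functions. -/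
def WeakConv {d : ℕ} (ρs : ℕ → Measure (Ed d)) (ρ : Measure (Ed d)) : Prop :=
  ∀ f : BoundedContinuousFunction (Ed d) ℝ,
    Tendsto (fun n => ∫ x, f x ∂(ρs n)) atTop (𝓝 (∫ x, f x ∂ρ))

/-- Convexity for extended-real-valued functions on `Ed d`. -/
def EConvexOn {d : ℕ} (u : Ed d → EReal) : Prop :=
  ∀ x y : Ed d, ∀ a b : ℝ, 0 ≤ a → 0 ≤ b → a + b = 1 →
    u (a • x + b • y) ≤ (a : EReal) * u x + (b : EReal) * u y

/-- `e^{-t}` for `t ∈ ℝ ∪ {+∞}`, with `e^{-∞} = 0`. -/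
def expNegE (t : EReal) : ℝ := if t = ⊤ then 0 else Real.exp (-t.toReal)

/-- The Legendre transform `u*(y) = sup_x (⟨x,y⟩ - u(x))`. -/
def legendre {d : ℕ} (u : Ed d → EReal) (y : Ed d) : EReal :=
  ⨆ x : Ed d, (((⟪x, y⟫ : ℝ) : EReal) - u x)

/-- The essential continuity of a convex l.s.c. function `u : ℝ^d → ℝ ∪ {+∞}`:
`u` tends to `+∞` at `H^{d-1}`-a.e. point of the boundary of its domain. -/
def EssentiallyContinuous {d : ℕ} (u : Ed d → EReal) : Prop :=
  μH[(d : ℝ) - 1] {x : Ed d | x ∈ frontier {y | u y < ⊤} ∧ u x < ⊤} = 0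

variable {d : ℕ}

theorem pairInt_eq_integral {γ : Measure (Ed d × Ed d)}
    (h : Integrable (fun p => (⟪p.1, p.2⟫ : ℝ)) γ) :
    pairInt γ = ((∫ p, (⟪p.1, p.2⟫ : ℝ) ∂γ : ℝ) : EReal) := by
  have hfin {f : Ed d × Ed d → ℝ} (hf : Integrable f γ) : ∫⁻ p, ENNReal.ofReal (f p) ∂γ ≠ ∞ :=
    hf.lintegral_lt_top.ne
  rw [integral_eq_lintegral_pos_part_sub_lintegral_neg_part h, EReal.coe_sub,
    EReal.coe_ennreal_toReal (hfin h)]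
  exact congrArg _ (EReal.coe_ennreal_toReal (hfin h.neg)).symm

theorem integrable_withDensity_ofReal {X E : Type*} [MeasurableSpace X] [NormedAddCommGroup E]
    [NormedSpace ℝ E] {σ : Measure X} {f : X → ℝ} {C : ℝ}
    (hC : ∀ x, f x ≤ C) {g : X → E} (hg : Integrable g σ) :
    Integrable g (σ.withDensity fun x => ENNReal.ofReal (f x)) := by
  refine Integrable.mono_measure (ν := ENNReal.ofReal C • σ)
    (hg.smul_measure ENNReal.ofReal_ne_top) ?_
  rw [← withDensity_const]
  exact withDensity_mono (ae_of_all _ fun x => ENNReal.ofReal_le_ofReal (hC x))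

theorem integral_withDensity_ofReal {X E : Type*} [MeasurableSpace X] [NormedAddCommGroup E]
    [NormedSpace ℝ E] {σ : Measure X} {f : X → ℝ} (hf : Measurable f) (hf0 : ∀ x, 0 ≤ f x)
    (g : X → E) :
    ∫ x, g x ∂(σ.withDensity fun x => ENNReal.ofReal (f x)) = ∫ x, f x • g x ∂σ := by
  rw [integral_withDensity_eq_integral_toReal_smul hf.ennreal_ofReal
    (ae_of_all _ fun _ => ENNReal.ofReal_lt_top)]
  simp [ENNReal.toReal_ofReal (hf0 _)]

theorem integrable_of_bounds {X : Type*} [MeasurableSpace X] {σ : Measure X} [IsFiniteMeasure σ]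
    {f : X → ℝ} (hf : Measurable f) (hf0 : ∀ x, 0 ≤ f x) {C : ℝ} (hC : ∀ x, f x ≤ C) :
    Integrable f σ :=
  .of_bound hf.aestronglyMeasurable C
    (ae_of_all _ fun x => by rw [Real.norm_of_nonneg (hf0 x)]; exact hC x)

theorem integrable_inner_prod {α β : Measure (Ed d)} [SFinite α] [SFinite β]
    (hα : Integrable id α) (hβ : Integrable id β) :
    Integrable (fun p : Ed d × Ed d => (⟪p.1, p.2⟫ : ℝ)) (α.prod β) :=
  hα.op_fst_snd (op := fun x y => (⟪x, y⟫ : ℝ)) (by fun_prop)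
    ⟨1, fun x y => by simpa using norm_inner_le_norm (𝕜 := ℝ) x y⟩ hβ

theorem integral_inner_prod_eq {α β : Measure (Ed d)} [SFinite α] [SFinite β]
    (hα : Integrable id α) (hβ : Integrable id β) :
    ∫ p, (⟪p.1, p.2⟫ : ℝ) ∂(α.prod β) = ∫ x, (⟪x, ∫ y, y ∂β⟫ : ℝ) ∂α := by
  rw [integral_prod _ (integrable_inner_prod hα hβ)]
  exact integral_congr_ae (ae_of_all _ fun x => integral_inner hβ x)

/-- Mixtures of product measures with total first density one are couplings, hence bound the
maximal correlation from below. -/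
theorem sum_le_maxCorr {ι : Type*} [Fintype ι] {σ μ : Measure (Ed d)} [IsProbabilityMeasure σ]
    (hσ : Integrable id σ) {f : ι → Ed d → ℝ} (hf : ∀ i, Measurable (f i))
    (hf0 : ∀ i x, 0 ≤ f i x) {C : ι → ℝ} (hC : ∀ i x, f i x ≤ C i)
    {l : ι → Measure (Ed d)} [∀ i, IsFiniteMeasure (l i)] (hl : ∀ i, Integrable id (l i))
    (h₁ : ∀ x, ∑ i, f i x * (l i).real Set.univ = 1)
    (h₂ : ∑ i, ENNReal.ofReal (∫ x, f i x ∂σ) • l i = μ) :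
    ((∑ i, ∫ x, f i x * (⟪x, ∫ y, y ∂(l i)⟫ : ℝ) ∂σ : ℝ) : EReal) ≤ maxCorr σ μ := by
  have hfi (i) : Integrable (f i) σ := integrable_of_bounds (hf i) (hf0 i) (hC i)
  have hlin (i) : ∫⁻ x, ENNReal.ofReal (f i x) ∂σ = ENNReal.ofReal (∫ x, f i x ∂σ) :=
    (ofReal_integral_eq_lintegral_ofReal (hfi i) (ae_of_all _ (hf0 i))).symm
  set w : ι → Measure (Ed d) := fun i => σ.withDensity fun x => ENNReal.ofReal (f i x) with hw
  have hwfin (i) : IsFiniteMeasure (w i) :=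
    isFiniteMeasure_withDensity (by rw [hlin]; exact ENNReal.ofReal_ne_top)
  have hwi (i) : Integrable id (w i) := integrable_withDensity_ofReal (hC i) hσ
  set γ : Measure (Ed d × Ed d) := ∑ i, (w i).prod (l i) with hγ
  have hfst : γ.fst = σ := by
    ext s hs
    rw [Measure.fst_apply hs, hγ, Measure.finsetSum_apply]
    have hterm (i) : (w i).prod (l i) (Prod.fst ⁻¹' s)
        = ∫⁻ x in s, ENNReal.ofReal (f i x * (l i).real Set.univ) ∂σ := by
      rw [← Set.prod_univ, Measure.prod_prod, hw, withDensity_apply _ hs,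
        ← lintegral_mul_const _ (hf i).ennreal_ofReal]
      exact lintegral_congr fun x => by rw [ENNReal.ofReal_mul (hf0 i x), ofReal_measureReal]
    simp_rw [hterm]
    rw [← lintegral_finsetSum _ fun i _ => ((hf i).mul_const _).ennreal_ofReal]
    simp_rw [← ENNReal.ofReal_sum_of_nonneg
      fun i _ => mul_nonneg (hf0 i _) measureReal_nonneg, h₁]
    simp
  have hsnd : γ.snd = μ := by
    ext s hs
    rw [Measure.snd_apply hs, hγ, ← h₂, Measure.finsetSum_apply, Measure.finsetSum_apply]
    refine Finset.sum_congr rfl fun i _ => ?_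
    rw [← Set.univ_prod, Measure.prod_prod, hw, withDensity_apply _ MeasurableSet.univ,
      setLIntegral_univ, hlin]
    rfl
  have hγp : IsProbabilityMeasure γ := ⟨by rw [← Measure.fst_univ, hfst, measure_univ]⟩
  have hint (i) : Integrable (fun p : Ed d × Ed d => (⟪p.1, p.2⟫ : ℝ)) ((w i).prod (l i)) :=
    integrable_inner_prod (hwi i) (hl i)
  have hpair : pairInt γ = ((∑ i, ∫ x, f i x * (⟪x, ∫ y, y ∂(l i)⟫ : ℝ) ∂σ : ℝ) : EReal) := by
    rw [pairInt_eq_integral (integrable_finsetSum_measure.2 fun i _ => hint i),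
      integral_finsetSum_measure fun i _ => hint i]
    congr 1
    refine Finset.sum_congr rfl fun i _ => ?_
    rw [integral_inner_prod_eq (hwi i) (hl i), integral_withDensity_ofReal (hf i) (hf0 i)]
    rfl
  rw [← hpair]
  exact le_iSup₂ (f := fun γ (_ : γ ∈ Couplings σ μ) => pairInt γ) γ ⟨hγp, hfst, hsnd⟩

/-- A subcoupling by products whose second marginal is a multiple of the centered measure `μ` can
be completed by an independent product without changing the correlation. -/
theorem sum_le_maxCorr_of_centered {ι : Type*} [Fintype ι] {σ μ : Measure (Ed d)}
    [IsProbabilityMeasure σ] [IsProbabilityMeasure μ]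
    (hσ : Integrable id σ) (hμ : Integrable id μ) (hμc : Centered μ)
    {f : ι → Ed d → ℝ} (hf : ∀ i, Measurable (f i))
    (hf0 : ∀ i x, 0 ≤ f i x) {C : ι → ℝ} (hC : ∀ i x, f i x ≤ C i)
    {l : ι → Measure (Ed d)} [∀ i, IsFiniteMeasure (l i)] (hl : ∀ i, Integrable id (l i))
    (h₁ : ∀ x, ∑ i, f i x * (l i).real Set.univ ≤ 1) {c : ℝ} (hc : 0 ≤ c)
    (h₂ : ∑ i, ENNReal.ofReal (∫ x, f i x ∂σ) • l i = ENNReal.ofReal c • μ) :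
    ((∑ i, ∫ x, f i x * (⟪x, ∫ y, y ∂(l i)⟫ : ℝ) ∂σ : ℝ) : EReal) ≤ maxCorr σ μ := by
  have hfi (i) : Integrable (f i) σ := integrable_of_bounds (hf i) (hf0 i) (hC i)
  have hmass : ∑ i, (∫ x, f i x ∂σ) * (l i).real Set.univ = c := by
    have := congrArg (fun ν : Measure (Ed d) => (ν Set.univ).toReal) h₂
    simp only [Measure.finsetSum_apply, Measure.smul_apply, smul_eq_mul, measure_univ, mul_one,
      ENNReal.toReal_ofReal hc] at this
    rw [ENNReal.toReal_sum fun i _ => by finiteness] at this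
    simpa [ENNReal.toReal_mul, ENNReal.toReal_ofReal (integral_nonneg (hf0 _)),
      Measure.real] using this
  set g : Ed d → ℝ := fun x => 1 - ∑ i, f i x * (l i).real Set.univ with hg
  have hgi : ∫ x, g x ∂σ = 1 - c := by
    rw [hg, integral_sub (integrable_const _)
      (integrable_finsetSum _ fun i _ => (hfi i).mul_const _),
      integral_finsetSum _ fun i _ => (hfi i).mul_const _]
    simp [integral_mul_const, hmass]
  have hg0 (x) : 0 ≤ g x := sub_nonneg.2 (h₁ x)
  have hc1 : 0 ≤ 1 - c := hgi ▸ integral_nonneg hg0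
  let f' : Option ι → Ed d → ℝ := fun o => o.elim g f
  let l' : Option ι → Measure (Ed d) := fun o => o.elim μ l
  have hl'fin (o) : IsFiniteMeasure (l' o) := by
    cases o <;> simp only [l', Option.elim] <;> infer_instance
  have key := sum_le_maxCorr (σ := σ) (μ := μ) hσ (f := f') (l := l')
    (C := fun o => o.elim 1 C) ?_ ?_ ?_ ?_ ?_ ?_
  · rw [Fintype.sum_option] at key
    have h0 : ∫ y, y ∂μ = 0 := hμc
    simpa [f', l', h0] using key
  · rintro (_ | i)
    · exact measurable_const.sub (Finset.measurable_sum _ fun i _ => (hf i).mul_const _)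
    · exact hf i
  · rintro (_ | i) x
    exacts [hg0 x, hf0 i x]
  · rintro (_ | i) x
    · exact sub_le_self _ (Finset.sum_nonneg fun i _ => mul_nonneg (hf0 i x) measureReal_nonneg)
    · exact hC i x
  · rintro (_ | i)
    exacts [hμ, hl i]
  · intro x
    simp [Fintype.sum_option, f', l', hg]
  · rw [Fintype.sum_option]
    simp only [f', l', Option.elim]
    rw [h₂, hgi, ← add_smul, ← ENNReal.ofReal_add hc1 hc]
    simp

theorem exists_finite_partition (R : ℝ) {δ : ℝ} (hδ : 0 < δ) :
    ∃ (t : Finset (Ed d)) (φ : t → Ed d → ℝ), (∀ i, Continuous (φ i)) ∧ (∀ i x, 0 ≤ φ i x) ∧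
      (∀ x, ∑ i, φ i x ≤ 1) ∧ (∀ x, ‖x‖ ≤ R → ∑ i, φ i x = 1) ∧
      ∀ i x, φ i x ≠ 0 → ‖x - i‖ ≤ δ := by
  obtain ⟨t, -, htf, hcov⟩ := (isCompact_closedBall (0 : Ed d) R).finite_cover_balls hδ
  lift t to Finset (Ed d) using htf
  obtain ⟨F, hF⟩ := PartitionOfUnity.exists_isSubordinate
    (Metric.isClosed_closedBall (x := (0 : Ed d)) (ε := R)) (fun i : t => Metric.ball (i : Ed d) δ)
    (fun _ => Metric.isOpen_ball) (by simpa [Set.iUnion_subtype] using hcov)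
  refine ⟨t, fun i => F i, fun i => (F i).continuous, F.nonneg, fun x => ?_, fun x hx => ?_,
    fun i x hx => ?_⟩
  · simpa [finsum_eq_sum_of_fintype] using F.sum_le_one x
  · simpa [finsum_eq_sum_of_fintype] using F.sum_eq_one (x := x) (by simpa using hx)
  · have := hF i (subset_tsupport _ hx)
    rw [Metric.mem_ball, dist_eq_norm] at this
    exact this.le

theorem WeakConv.tendsto_integral {ρs : ℕ → Measure (Ed d)} {ρ : Measure (Ed d)}
    (h : WeakConv ρs ρ) {f : Ed d → ℝ} (hf : Continuous f) {C : ℝ} (hC : ∀ x, |f x| ≤ C) :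
    Tendsto (fun n => ∫ x, f x ∂(ρs n)) atTop (𝓝 (∫ x, f x ∂ρ)) :=
  h (BoundedContinuousFunction.ofNormedAddCommGroup f hf C hC)

theorem abs_mul_inner_le {φ : Ed d → ℝ} (h0 : ∀ x, 0 ≤ φ x) (h1 : ∀ x, φ x ≤ 1) {z : Ed d} {δ : ℝ}
    (hδ : 0 ≤ δ) (hsupp : ∀ x, φ x ≠ 0 → ‖x - z‖ ≤ δ) (x v : Ed d) :
    |φ x * (⟪x, v⟫ : ℝ)| ≤ (‖z‖ + δ) * ‖v‖ := by
  by_cases hx : φ x = 0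
  · rw [hx, zero_mul, abs_zero]; positivity
  · have hxz : ‖x‖ ≤ ‖z‖ + δ := (norm_le_norm_add_norm_sub' x z).trans (by gcongr; exact hsupp x hx)
    rw [abs_mul, abs_of_nonneg (h0 x)]
    calc φ x * |(⟪x, v⟫ : ℝ)| ≤ 1 * (‖x‖ * ‖v‖) :=
          mul_le_mul (h1 x) (abs_real_inner_le_norm x v) (abs_nonneg _) zero_le_one
      _ ≤ (‖z‖ + δ) * ‖v‖ := by rw [one_mul]; gcongr

/-- Correlations of plans built from finitely many compactly supported weights pass to the limit
along weakly converging sequences. -/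
theorem le_liminf_maxCorr_of_lt_sum {ι : Type*} [Fintype ι] {μ : Measure (Ed d)}
    [IsProbabilityMeasure μ] (hμ : Integrable id μ) (hμc : Centered μ)
    {ρs : ℕ → Measure (Ed d)} {ρ : Measure (Ed d)} [∀ n, IsProbabilityMeasure (ρs n)]
    (hρs : ∀ n, Integrable id (ρs n)) (hconv : WeakConv ρs ρ)
    {φ : ι → Ed d → ℝ} (hφ : ∀ i, Continuous (φ i)) (hφ0 : ∀ i x, 0 ≤ φ i x)
    (hφ1 : ∀ x, ∑ i, φ i x ≤ 1) {z : ι → Ed d} {δ : ℝ} (hδ : 0 ≤ δ)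
    (hsupp : ∀ i x, φ i x ≠ 0 → ‖x - z i‖ ≤ δ)
    {l : ι → Measure (Ed d)} [∀ i, IsFiniteMeasure (l i)] (hl : ∀ i, Integrable id (l i))
    (hmass : ∀ i, (l i).real Set.univ = ∫ x, φ i x ∂ρ) {c : ℝ} (hc : 0 ≤ c)
    (hsum : ∑ i, l i = ENNReal.ofReal c • μ) {a : ℝ}
    (ha : a < ∑ i, (∫ x, φ i x ∂ρ)⁻¹ * ∫ x, φ i x * (⟪x, ∫ y, y ∂(l i)⟫ : ℝ) ∂ρ) :
    (a : EReal) ≤ liminf (fun n => maxCorr (ρs n) μ) atTop := by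
  have hφle (i x) : φ i x ≤ 1 :=
    (Finset.single_le_sum (fun j _ => hφ0 j x) (Finset.mem_univ i)).trans (hφ1 x)
  set m : ι → ℝ := fun i => ∫ x, φ i x ∂ρ
  set v : ι → Ed d := fun i => ∫ y, y ∂(l i) with hv
  set V : ℝ := ∑ i, (m i)⁻¹ * ∫ x, φ i x * (⟪x, v i⟫ : ℝ) ∂ρ with hV
  have hm0 (i) : 0 ≤ m i := integral_nonneg (hφ0 i)
  obtain ⟨η, ⟨haη, hη0⟩, hη1⟩ : ∃ η : ℝ, (a < η * V ∧ 0 < η) ∧ η < 1 := by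
    have h1 : ∀ᶠ η : ℝ in 𝓝[<] 1, a < η * V := by
      refine (ContinuousAt.eventually_lt (f := fun _ => a) (g := fun η : ℝ => η * V)
        (x₀ := 1) (by fun_prop) (by fun_prop) (by simpa using ha)).filter_mono nhdsWithin_le_nhds
    have h2 : ∀ᶠ η : ℝ in 𝓝[<] 1, 0 < η :=
      (lt_mem_nhds one_pos).filter_mono nhdsWithin_le_nhds
    exact ((h1.and h2).and self_mem_nhdsWithin).exists
  set mn : ℕ → ι → ℝ := fun n i => ∫ x, φ i x ∂(ρs n)
  have hmn0 (n i) : 0 ≤ mn n i := integral_nonneg (hφ0 i)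
  have hmlim (i) : Tendsto (fun n => mn n i) atTop (𝓝 (m i)) :=
    hconv.tendsto_integral (hφ i) (C := 1) fun x => by rw [abs_of_nonneg (hφ0 i x)]; exact hφle i x
  have hev : ∀ᶠ n in atTop, ∀ i, m i = 0 ∨ η * m i < mn n i := by
    refine eventually_all.2 fun i => ?_
    rcases (hm0 i).eq_or_lt' with h | h
    · exact Eventually.of_forall fun _ => Or.inl h
    · filter_upwards [(hmlim i).eventually_const_lt (mul_lt_of_lt_one_left h hη1)] with n hn
      exact Or.inr hn
  have hl0 (i) (h : m i = 0) : l i = 0 := by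
    have := hmass i
    rw [show ∫ x, φ i x ∂ρ = 0 from h, measureReal_eq_zero_iff] at this
    exact Measure.measure_univ_eq_zero.1 this
  have hlim : Tendsto (fun n => ∑ i, ∫ x, η / mn n i * φ i x * (⟪x, v i⟫ : ℝ) ∂(ρs n)) atTop
      (𝓝 (η * V)) := by
    rw [hV, Finset.mul_sum]
    refine tendsto_finsetSum _ fun i _ => ?_
    simp_rw [mul_assoc, integral_const_mul]
    by_cases h : m i = 0
    · simp [hv, hl0 i h]
    · rw [← mul_assoc, ← div_eq_mul_inv]
      exact ((tendsto_const_nhds.div (hmlim i) h)).mul (hconv.tendsto_integral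
        (by have := hφ i; fun_prop)
        fun x => abs_mul_inner_le (hφ0 i) (hφle i) hδ (hsupp i) x (v i))
  refine le_liminf_of_le (by isBoundedDefault) ?_
  filter_upwards [hev, hlim.eventually_const_lt haη] with n hn han
  refine (EReal.coe_le_coe_iff.2 han.le).trans ?_
  refine sum_le_maxCorr_of_centered (hρs n) hμ hμc (f := fun i x => η / mn n i * φ i x)
    (C := fun i => η / mn n i) (c := η * c)
    (fun i => ((hφ i).measurable.const_mul _))
    (fun i x => mul_nonneg (div_nonneg hη0.le (hmn0 n i)) (hφ0 i x))
    (fun i x => mul_le_of_le_one_right (div_nonneg hη0.le (hmn0 n i)) (hφle i x)) hl ?_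
    (by positivity) ?_
  · intro x
    refine (Finset.sum_le_sum fun i _ => ?_).trans (hφ1 x)
    rw [hmass i]
    change η / mn n i * φ i x * m i ≤ φ i x
    rcases hn i with h | h
    · simpa [h] using hφ0 i x
    · have hpos : 0 < mn n i := (mul_nonneg hη0.le (hm0 i)).trans_lt h
      calc η / mn n i * φ i x * m i = (η * m i / mn n i) * φ i x := by ring
        _ ≤ 1 * φ i x := by
            gcongr
            · exact hφ0 i x
            · exact (div_le_one hpos).2 h.le
        _ = φ i x := one_mul _
  · rw [ENNReal.ofReal_mul hη0.le, mul_smul, ← hsum, Finset.smul_sum]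
    refine Finset.sum_congr rfl fun i _ => ?_
    rcases hn i with h | h
    · simp [hl0 i h]
    · have hpos : 0 < mn n i := (mul_nonneg hη0.le (hm0 i)).trans_lt h
      rw [integral_const_mul]
      change ENNReal.ofReal (η / mn n i * mn n i) • _ = _
      rw [div_mul_cancel₀ _ hpos.ne']

/-- Replacing a localized weighted correlation by the product of the weighted means costs at most
twice the localization radius times the weighted first moment. -/
theorem le_inner_weighted_means {Ω : Type*} [MeasurableSpace Ω] {P : Measure Ω} [IsFiniteMeasure P]
    {X Y : Ω → Ed d} (hX : Integrable X P) (hY : Integrable Y P) {w : Ω → ℝ} (hw : Measurable w)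
    (hw0 : ∀ ω, 0 ≤ w ω) (hw1 : ∀ ω, w ω ≤ 1) {z : Ed d} {δ : ℝ} (hδ : 0 ≤ δ)
    (hsupp : ∀ ω, w ω ≠ 0 → ‖X ω - z‖ ≤ δ) {q : ℝ} (hq : 0 ≤ q) (t : Ed d)
    (hXY : Integrable (fun ω => w ω * (⟪X ω, Y ω⟫ : ℝ)) P) :
    q * (∫ ω, w ω * (⟪X ω, Y ω⟫ : ℝ) ∂P - 2 * δ * ∫ ω, w ω * ‖Y ω‖ ∂P)
        - ‖t‖ * ∫ ω, w ω * ‖X ω‖ ∂P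
      ≤ (∫ ω, w ω ∂P)⁻¹ *
        (⟪∫ ω, w ω • X ω ∂P, q • ∫ ω, w ω • Y ω ∂P + (∫ ω, w ω ∂P) • t⟫ : ℝ) := by
  have hwi : Integrable w P := integrable_of_bounds hw hw0 hw1
  have hwb : ∀ᵐ ω ∂P, ‖w ω‖ ≤ 1 :=
    ae_of_all _ fun ω => by rw [Real.norm_of_nonneg (hw0 ω)]; exact hw1 ω
  have hwX : Integrable (fun ω => w ω • X ω) P := hX.bdd_smul 1 hw.aestronglyMeasurable hwb
  have hwY : Integrable (fun ω => w ω • Y ω) P := hY.bdd_smul 1 hw.aestronglyMeasurable hwb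
  have hwnX : ‖∫ ω, w ω • X ω ∂P‖ ≤ ∫ ω, w ω * ‖X ω‖ ∂P :=
    (norm_integral_le_integral_norm _).trans_eq
      (by simp_rw [norm_smul, Real.norm_of_nonneg (hw0 _)])
  have hwnY : ‖∫ ω, w ω • Y ω ∂P‖ ≤ ∫ ω, w ω * ‖Y ω‖ ∂P :=
    (norm_integral_le_integral_norm _).trans_eq
      (by simp_rw [norm_smul, Real.norm_of_nonneg (hw0 _)])
  have hwY' : Integrable (fun ω => w ω * ‖Y ω‖) P :=
    hwY.norm.congr (ae_of_all _ fun ω => by simp [norm_smul, abs_of_nonneg (hw0 ω)])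
  set m := ∫ ω, w ω ∂P with hm
  rcases (integral_nonneg hw0 : 0 ≤ m).eq_or_lt' with (h : m = 0) | (h : 0 < m)
  · have hae : w =ᵐ[P] 0 := (integral_eq_zero_iff_of_nonneg hw0 hwi).1 h
    have hz (g : Ω → ℝ) : ∫ ω, w ω * g ω ∂P = 0 :=
      integral_eq_zero_of_ae (by filter_upwards [hae] with ω hω; simp [hω])
    simp [hz, h]
  set b := ∫ ω, w ω • X ω ∂P with hb
  set u := ∫ ω, w ω • Y ω ∂P with hu
  have hbz : ‖b - m • z‖ ≤ δ * m := by
    rw [hb, hm, ← integral_smul_const, ← integral_sub hwX (hwi.smul_const z), ← integral_const_mul]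
    refine norm_integral_le_of_norm_le (hwi.const_mul δ) (ae_of_all _ fun ω => ?_)
    rw [← smul_sub, norm_smul, Real.norm_of_nonneg (hw0 ω), mul_comm]
    by_cases hω : w ω = 0
    · simp [hω]
    · exact mul_le_mul_of_nonneg_right (hsupp ω hω) (hw0 ω)
  have hzu : (⟪z, u⟫ : ℝ) = ∫ ω, w ω * (⟪z, Y ω⟫ : ℝ) ∂P := by
    rw [hu, ← integral_inner hwY]
    simp_rw [inner_smul_right]
  have hzY : Integrable (fun ω => w ω * (⟪z, Y ω⟫ : ℝ)) P :=
    (hwY.const_inner (𝕜 := ℝ) z).congr (ae_of_all _ fun ω => by simp [inner_smul_right])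
  have hloc : ∫ ω, w ω * (⟪X ω, Y ω⟫ : ℝ) ∂P ≤ ⟪z, u⟫ + δ * ∫ ω, w ω * ‖Y ω‖ ∂P := by
    rw [hzu, ← integral_const_mul, ← integral_add hzY (hwY'.const_mul δ)]
    refine integral_mono hXY (hzY.add (hwY'.const_mul δ)) fun ω => ?_
    by_cases hω : w ω = 0
    · simp [hω]
    · have h1 : (⟪X ω, Y ω⟫ : ℝ) - ⟪z, Y ω⟫ ≤ δ * ‖Y ω‖ := by
        rw [← inner_sub_left]
        exact (real_inner_le_norm _ _).trans (by gcongr; exact hsupp ω hω)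
      have h2 := mul_le_mul_of_nonneg_left h1 (hw0 ω)
      simp only
      linarith
  have hmean : (⟪z, u⟫ : ℝ) - δ * ∫ ω, w ω * ‖Y ω‖ ∂P ≤ m⁻¹ * ⟪b, u⟫ := by
    have h1 : -(δ * m * ∫ ω, w ω * ‖Y ω‖ ∂P) ≤ (⟪b - m • z, u⟫ : ℝ) := by
      refine neg_le_of_abs_le ((abs_real_inner_le_norm _ _).trans ?_)
      gcongr
    rw [inner_sub_left, real_inner_smul_left] at h1
    rw [inv_mul_eq_div, le_div_iff₀ h]
    linarith
  have hbt : -(‖t‖ * ∫ ω, w ω * ‖X ω‖ ∂P) ≤ (⟪b, t⟫ : ℝ) := by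
    refine neg_le_of_abs_le ((abs_real_inner_le_norm _ _).trans ?_)
    rw [mul_comm]
    gcongr
  rw [inner_add_right, real_inner_smul_right, real_inner_smul_right, mul_add,
    inv_mul_cancel_left₀ h.ne']
  have := mul_le_mul_of_nonneg_left (hmean.trans' (by linarith :
    ∫ ω, w ω * (⟪X ω, Y ω⟫ : ℝ) ∂P - 2 * δ * ∫ ω, w ω * ‖Y ω‖ ∂P ≤ _)) hq
  linarith [mul_left_comm m⁻¹ q (⟪b, u⟫ : ℝ)]

/-- Truncated correlations eventually exceed every real number below the full correlation. -/
theorem eventually_lt_integral_mul_inner {γ : Measure (Ed d × Ed d)} {a : ℝ}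
    (ha : (a : EReal) < pairInt γ) {χ : ℕ → Ed d → ℝ} (hχ : ∀ k, Measurable (χ k))
    (hχ0 : ∀ k x, 0 ≤ χ k x) (hχ1 : ∀ k x, χ k x ≤ 1) (hχR : ∀ (k : ℕ) x, ‖x‖ ≤ k → χ k x = 1)
    (hint : ∀ k, Integrable (fun p : Ed d × Ed d => χ k p.1 * (⟪p.1, p.2⟫ : ℝ)) γ) :
    ∀ᶠ k in atTop, a < ∫ p, χ k p.1 * (⟪p.1, p.2⟫ : ℝ) ∂γ := by
  set N : ℝ≥0∞ := ∫⁻ p, ENNReal.ofReal (-(⟪p.1, p.2⟫ : ℝ)) ∂γ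
  set A : ℝ≥0∞ := ∫⁻ p, ENNReal.ofReal (⟪p.1, p.2⟫ : ℝ) ∂γ
  have hscale {c s : ℝ} (hc0 : 0 ≤ c) (hc1 : c ≤ 1) :
      ENNReal.ofReal (c * s) ≤ ENNReal.ofReal s := by
    rw [ENNReal.ofReal_mul hc0]
    exact mul_le_of_le_one_left' (ENNReal.ofReal_le_one.2 hc1)
  have hpair : pairInt γ = (A : EReal) - (N : EReal) := rfl
  have hNtop : N ≠ ⊤ := by
    intro h
    rw [hpair, h, EReal.coe_ennreal_top, EReal.sub_top] at ha
    exact not_lt_bot ha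
  set Ak : ℕ → ℝ≥0∞ := fun k => ∫⁻ p, ENNReal.ofReal (χ k p.1 * (⟪p.1, p.2⟫ : ℝ)) ∂γ
  have hlim : Tendsto Ak atTop (𝓝 A) := by
    refine tendsto_of_le_liminf_of_limsup_le ?_ ?_
    · refine le_trans (le_of_eq ?_) (lintegral_liminf_le fun k =>
        (((hχ k).comp measurable_fst).mul (by fun_prop)).ennreal_ofReal)
      refine lintegral_congr fun p => ?_
      symm
      refine Tendsto.liminf_eq (tendsto_const_nhds.congr' ?_)
      filter_upwards [eventually_ge_atTop ⌈‖p.1‖⌉₊] with k hk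
      simp [hχR k p.1 (Nat.ceil_le.1 hk)]
    · refine limsup_le_of_le (by isBoundedDefault) (Eventually.of_forall fun k => ?_)
      exact lintegral_mono fun p => hscale (hχ0 k _) (hχ1 k _)
  have hlt : (a : EReal) + (N : EReal) < (A : EReal) := EReal.add_lt_of_lt_sub (hpair ▸ ha)
  filter_upwards [((continuous_coe_ennreal_ereal.tendsto A).comp hlim).eventually_const_lt hlt]
    with k hk
  have hneg : ∫⁻ p, ENNReal.ofReal (-(χ k p.1 * (⟪p.1, p.2⟫ : ℝ))) ∂γ ≤ N :=
    lintegral_mono fun p => by rw [← mul_neg]; exact hscale (hχ0 k _) (hχ1 k _)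
  rw [integral_eq_lintegral_pos_part_sub_lintegral_neg_part (hint k), lt_sub_iff_add_lt]
  have h1 : a + N.toReal < (Ak k).toReal := by
    have hAkt : Ak k ≠ ⊤ := (hint k).lintegral_lt_top.ne
    simp only [Function.comp_apply] at hk
    rwa [← EReal.coe_ennreal_toReal hNtop, ← EReal.coe_ennreal_toReal hAkt, ← EReal.coe_add,
      EReal.coe_lt_coe_iff] at hk
  have h2 := ENNReal.toReal_mono hNtop hneg
  exact lt_of_le_of_lt (by gcongr) h1

/-- The second marginal of `γ` reweighted by a function of the first variable. -/
def weightedSnd (γ : Measure (Ed d × Ed d)) (f : Ed d → ℝ) : Measure (Ed d) :=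
  (γ.withDensity fun p => ENNReal.ofReal (f p.1)).snd

section weightedSnd

variable {γ : Measure (Ed d × Ed d)} {f : Ed d → ℝ}

theorem weightedSnd_apply {s : Set (Ed d)} (hs : MeasurableSet s) :
    weightedSnd γ f s = ∫⁻ p in Prod.snd ⁻¹' s, ENNReal.ofReal (f p.1) ∂γ := by
  rw [weightedSnd, Measure.snd_apply hs, withDensity_apply _ (measurable_snd hs)]

theorem sum_weightedSnd_add {ι : Type*} [Fintype ι] {φ : ι → Ed d → ℝ}
    (hφ : ∀ i, Measurable (φ i)) (hφ0 : ∀ i x, 0 ≤ φ i x) (hφ1 : ∀ x, ∑ i, φ i x ≤ 1) :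
    ∑ i, weightedSnd γ (φ i) + weightedSnd γ (fun x => 1 - ∑ i, φ i x) = γ.snd := by
  ext s hs
  rw [Measure.add_apply, Measure.finsetSum_apply, Measure.snd_apply hs]
  simp_rw [weightedSnd_apply hs]
  have hm (i) : Measurable fun p : Ed d × Ed d => ENNReal.ofReal (φ i p.1) :=
    ((hφ i).comp measurable_fst).ennreal_ofReal
  rw [← lintegral_finsetSum _ fun i _ => hm i,
    ← lintegral_add_left (Finset.measurable_sum _ fun i _ => hm i)]
  have (p : Ed d × Ed d) :
      ∑ i, ENNReal.ofReal (φ i p.1) + ENNReal.ofReal (1 - ∑ i, φ i p.1) = 1 := by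
    rw [← ENNReal.ofReal_sum_of_nonneg fun i _ => hφ0 i _,
      ← ENNReal.ofReal_add (Finset.sum_nonneg fun i _ => hφ0 i _) (sub_nonneg.2 (hφ1 _))]
    simp
  simp [this]

theorem weightedSnd_univ [IsFiniteMeasure γ] (hf : Measurable f) (hf0 : ∀ x, 0 ≤ f x)
    (hf1 : ∀ x, f x ≤ 1) :
    weightedSnd γ f Set.univ = ENNReal.ofReal (∫ p, f p.1 ∂γ) := by
  rw [weightedSnd_apply MeasurableSet.univ, Set.preimage_univ, setLIntegral_univ]
  exact (ofReal_integral_eq_lintegral_ofReal (f := fun p : Ed d × Ed d => f p.1)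
    (integrable_of_bounds (hf.comp measurable_fst) (fun p => hf0 p.1) fun p => hf1 p.1)
    (ae_of_all _ fun p => hf0 p.1)).symm

theorem isFiniteMeasure_weightedSnd [IsFiniteMeasure γ] (hf : Measurable f)
    (hf0 : ∀ x, 0 ≤ f x) (hf1 : ∀ x, f x ≤ 1) : IsFiniteMeasure (weightedSnd γ f) :=
  ⟨by rw [weightedSnd_univ hf hf0 hf1]; exact ENNReal.ofReal_lt_top⟩

theorem integrable_weightedSnd (hf1 : ∀ x, f x ≤ 1) (hγ : Integrable Prod.snd γ) :
    Integrable id (weightedSnd γ f) := by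
  have h : Integrable Prod.snd (γ.withDensity fun p => ENNReal.ofReal (f p.1)) :=
    integrable_withDensity_ofReal (f := fun p : Ed d × Ed d => f p.1) (fun p => hf1 p.1) hγ
  exact (integrable_map_measure aestronglyMeasurable_id measurable_snd.aemeasurable).2 h

theorem integral_weightedSnd (hf : Measurable f) (hf0 : ∀ x, 0 ≤ f x) :
    ∫ y, y ∂(weightedSnd γ f) = ∫ p, f p.1 • p.2 ∂γ := by
  rw [weightedSnd, Measure.snd, integral_map (f := fun y => y) measurable_snd.aemeasurable
    aestronglyMeasurable_id]
  exact integral_withDensity_ofReal (f := fun p : Ed d × Ed d => f p.1)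
    (hf.comp measurable_fst) (fun p => hf0 p.1) _

end weightedSnd

theorem integral_one_sub_smul_tendsto_zero {γ : Measure (Ed d × Ed d)}
    (hY : Integrable Prod.snd γ) {χ : ℕ → Ed d → ℝ} (hχ : ∀ k, Measurable (χ k))
    (hχ0 : ∀ k x, 0 ≤ χ k x) (hχ1 : ∀ k x, χ k x ≤ 1)
    (hχR : ∀ (k : ℕ) x, ‖x‖ ≤ k → χ k x = 1) :
    Tendsto (fun k => ∫ p, (1 - χ k p.1) • p.2 ∂γ) atTop (𝓝 0) := by
  rw [← integral_zero (Ed d × Ed d) (Ed d) (μ := γ)]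
  refine tendsto_integral_of_dominated_convergence (fun p => ‖p.2‖)
    (fun k => ((measurable_const.sub ((hχ k).comp measurable_fst)).aestronglyMeasurable.smul
      hY.aestronglyMeasurable)) hY.norm (fun k => ae_of_all _ fun p => ?_) (ae_of_all _ fun p => ?_)
  · rw [norm_smul, Real.norm_of_nonneg (sub_nonneg.2 (hχ1 k _))]
    exact mul_le_of_le_one_left (norm_nonneg _) (sub_le_self _ (hχ0 k _))
  · refine tendsto_const_nhds.congr' ?_
    filter_upwards [eventually_ge_atTop ⌈‖p.1‖⌉₊] with k hk
    simp [hχR k p.1 (Nat.ceil_le.1 hk)]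

theorem integral_cutoff_tendsto_one {γ : Measure (Ed d × Ed d)} [IsProbabilityMeasure γ]
    {χ : ℕ → Ed d → ℝ} (hχ : ∀ k, Measurable (χ k))
    (hχ0 : ∀ k x, 0 ≤ χ k x) (hχ1 : ∀ k x, χ k x ≤ 1)
    (hχR : ∀ (k : ℕ) x, ‖x‖ ≤ k → χ k x = 1) :
    Tendsto (fun k => ∫ p, χ k p.1 ∂γ) atTop (𝓝 1) := by
  have h1 : ∫ _ : Ed d × Ed d, (1 : ℝ) ∂γ = 1 := by simp
  rw [← h1]
  refine tendsto_integral_of_dominated_convergence (fun _ => 1)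
    (fun k => ((hχ k).comp measurable_fst).aestronglyMeasurable) (integrable_const _)
    (fun k => ae_of_all _ fun p => ?_) (ae_of_all _ fun p => ?_)
  · rw [Real.norm_of_nonneg (hχ0 k _)]
    exact hχ1 k _
  · refine tendsto_const_nhds.congr' ?_
    filter_upwards [eventually_ge_atTop ⌈‖p.1‖⌉₊] with k hk
    simp [hχR k p.1 (Nat.ceil_le.1 hk)]

/-- Any coupling is approximated by a discretized plan, whose mass outside a compact set is sent
independently to `μ`; such plans survive weak limits. -/
theorem le_liminf_maxCorr_of_lt_discretized {γ : Measure (Ed d × Ed d)} [IsProbabilityMeasure γ]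
    {μ : Measure (Ed d)} [IsProbabilityMeasure μ] (hμ : Integrable id μ) (hμc : Centered μ)
    {ρs : ℕ → Measure (Ed d)} {ρ : Measure (Ed d)} [∀ n, IsProbabilityMeasure (ρs n)]
    (hρs : ∀ n, Integrable id (ρs n)) (hconv : WeakConv ρs ρ)
    (hfst : γ.fst = ρ) (hsnd : γ.snd = μ) (hX : Integrable Prod.fst γ) (hY : Integrable Prod.snd γ)
    {ι : Type*} [Fintype ι]
    {φ : ι → Ed d → ℝ} (hφ : ∀ i, Continuous (φ i)) (hφ0 : ∀ i x, 0 ≤ φ i x)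
    (hφ1 : ∀ x, ∑ i, φ i x ≤ 1) {z : ι → Ed d} {δ : ℝ} (hδ : 0 ≤ δ)
    (hsupp : ∀ i x, φ i x ≠ 0 → ‖x - z i‖ ≤ δ)
    (hint : ∀ i, Integrable (fun p : Ed d × Ed d => φ i p.1 * (⟪p.1, p.2⟫ : ℝ)) γ) {a : ℝ}
    (ha : a < (∫ p, ∑ i, φ i p.1 ∂γ) *
        (∫ p, (∑ i, φ i p.1) * (⟪p.1, p.2⟫ : ℝ) ∂γ - 2 * δ * ∫ p, ‖p.2‖ ∂γ)
      - ‖∫ p, (1 - ∑ i, φ i p.1) • p.2 ∂γ‖ * ∫ p, ‖p.1‖ ∂γ) :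
    (a : EReal) ≤ liminf (fun n => maxCorr (ρs n) μ) atTop := by
  have hφle (i x) : φ i x ≤ 1 :=
    (Finset.single_le_sum (fun j _ => hφ0 j x) (Finset.mem_univ i)).trans (hφ1 x)
  have hφm (i) : Measurable (φ i) := (hφ i).measurable
  have hχm : Measurable fun x => 1 - ∑ i, φ i x :=
    measurable_const.sub (Finset.measurable_sum _ fun i _ => hφm i)
  have hχ0 (x) : 0 ≤ ∑ i, φ i x := Finset.sum_nonneg fun i _ => hφ0 i x
  have htr {E : Type} [NormedAddCommGroup E] [NormedSpace ℝ E] {g : Ed d → E}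
      (hg : AEStronglyMeasurable g ρ) : ∫ x, g x ∂ρ = ∫ p, g p.1 ∂γ := by
    subst hfst
    exact integral_map measurable_fst.aemeasurable hg
  have hφγ (i) : Integrable (fun p : Ed d × Ed d => φ i p.1) γ :=
    integrable_of_bounds ((hφm i).comp measurable_fst) (fun p => hφ0 i p.1) fun p => hφle i p.1
  have hφn (i) (p : Ed d × Ed d) : ‖φ i p.1‖ ≤ 1 := by
    rw [Real.norm_of_nonneg (hφ0 i _)]
    exact hφle i _
  have hwint (i) {g : Ed d × Ed d → Ed d} (hg : Integrable g γ) :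
      Integrable (fun p => φ i p.1 * ‖g p‖) γ :=
    hg.norm.bdd_mul (c := 1) ((hφm i).comp measurable_fst).aestronglyMeasurable
      (ae_of_all _ (hφn i))
  have hwle {g : Ed d × Ed d → Ed d} (hg : Integrable g γ) :
      ∑ i, ∫ p, φ i p.1 * ‖g p‖ ∂γ ≤ ∫ p, ‖g p‖ ∂γ := by
    rw [← integral_finsetSum _ fun i _ => hwint i hg]
    refine integral_mono (integrable_finsetSum _ fun i _ => hwint i hg) hg.norm fun p => ?_
    simp only [← Finset.sum_mul]
    exact mul_le_of_le_one_left (norm_nonneg _) (hφ1 _)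
  set q : ℝ := ∫ p, ∑ i, φ i p.1 ∂γ with hq
  have hq0 : 0 ≤ q := integral_nonneg fun p => hχ0 p.1
  set t : Ed d := ∫ p, (1 - ∑ i, φ i p.1) • p.2 ∂γ
  set m : ι → ℝ := fun i => ∫ p, φ i p.1 ∂γ
  have hm0 (i) : 0 ≤ m i := integral_nonneg fun p => hφ0 i p.1
  have hmq : ∑ i, m i = q := (integral_finsetSum _ fun i _ => hφγ i).symm
  set τ := weightedSnd γ fun x => 1 - ∑ i, φ i x
  have hτfin : IsFiniteMeasure τ := isFiniteMeasure_weightedSnd hχm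
    (fun x => sub_nonneg.2 (hφ1 x)) fun x => sub_le_self _ (hχ0 x)
  have hνfin (i) : IsFiniteMeasure (weightedSnd γ (φ i)) :=
    isFiniteMeasure_weightedSnd (hφm i) (hφ0 i) (hφle i)
  have hτi : Integrable id τ := integrable_weightedSnd (fun x => sub_le_self _ (hχ0 x)) hY
  have hνi (i) : Integrable id (weightedSnd γ (φ i)) := integrable_weightedSnd (hφle i) hY
  have h1q : 0 ≤ ∫ p : Ed d × Ed d, (1 - ∑ i, φ i p.1) ∂γ :=
    integral_nonneg fun p => sub_nonneg.2 (hφ1 p.1)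
  have hτmass : τ.real Set.univ = 1 - q := by
    rw [Measure.real, weightedSnd_univ hχm (fun x => sub_nonneg.2 (hφ1 x))
      (fun x => sub_le_self _ (hχ0 x)),
      ENNReal.toReal_ofReal h1q,
      integral_sub (integrable_const _) (integrable_finsetSum _ fun i _ => hφγ i)]
    simp [hq]
  have hνmass (i) : (weightedSnd γ (φ i)).real Set.univ = m i := by
    rw [Measure.real, weightedSnd_univ (hφm i) (hφ0 i) (hφle i), ENNReal.toReal_ofReal (hm0 i)]
  have hτmean : ∫ y, y ∂τ = t := integral_weightedSnd hχm fun x => sub_nonneg.2 (hφ1 x)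
  let l : ι → Measure (Ed d) := fun i =>
    ENNReal.ofReal q • weightedSnd γ (φ i) + ENNReal.ofReal (m i) • τ
  have hlfin (i) : IsFiniteMeasure (l i) :=
    ⟨by simp only [l, Measure.add_apply, Measure.smul_apply, smul_eq_mul]; finiteness⟩
  have hli (i) : Integrable id (l i) :=
    ((hνi i).smul_measure ENNReal.ofReal_ne_top).add_measure
      (hτi.smul_measure ENNReal.ofReal_ne_top)
  have hlmean (i) : ∫ y, y ∂(l i) = q • ∫ p, φ i p.1 • p.2 ∂γ + m i • t := by
    simp only [l]
    rw [integral_add_measure (f := fun y => y) ((hνi i).smul_measure ENNReal.ofReal_ne_top)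
      (hτi.smul_measure ENNReal.ofReal_ne_top), integral_smul_measure, integral_smul_measure,
      ENNReal.toReal_ofReal hq0, ENNReal.toReal_ofReal (hm0 i), hτmean,
      integral_weightedSnd (hφm i) (hφ0 i)]
  have hmρ (i) : ∫ x, φ i x ∂ρ = m i := htr (hφm i).aestronglyMeasurable
  refine le_liminf_maxCorr_of_lt_sum hμ hμc hρs hconv hφ hφ0 hφ1 hδ hsupp (l := l) hli ?_ hq0 ?_ ?_
  · intro i
    rw [hmρ]
    simp only [l]
    rw [measureReal_add_apply (ENNReal.mul_ne_top ENNReal.ofReal_ne_top (measure_ne_top _ _))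
        (ENNReal.mul_ne_top ENNReal.ofReal_ne_top (measure_ne_top _ _)),
      measureReal_ennreal_smul_apply, measureReal_ennreal_smul_apply,
      hτmass, hνmass, ENNReal.toReal_ofReal hq0, ENNReal.toReal_ofReal (hm0 i)]
    ring
  · simp only [l]
    rw [Finset.sum_add_distrib, ← Finset.smul_sum, ← Finset.sum_smul,
      ← ENNReal.ofReal_sum_of_nonneg fun i _ => hm0 i, hmq, ← smul_add,
      sum_weightedSnd_add hφm hφ0 hφ1, hsnd]
  · refine ha.trans_le ?_
    have hterm (i) : (∫ x, φ i x ∂ρ)⁻¹ * ∫ x, φ i x * (⟪x, ∫ y, y ∂(l i)⟫ : ℝ) ∂ρ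
        = (m i)⁻¹ * (⟪∫ p, φ i p.1 • p.1 ∂γ, q • ∫ p, φ i p.1 • p.2 ∂γ + m i • t⟫ : ℝ) := by
      rw [hmρ, hlmean]
      generalize q • ∫ p, φ i p.1 • p.2 ∂γ + m i • t = v
      rw [htr (g := fun x => φ i x * (⟪x, v⟫ : ℝ))
        ((hφm i).mul (by fun_prop)).aestronglyMeasurable]
      congr 1
      have hXi : Integrable (fun p : Ed d × Ed d => φ i p.1 • p.1) γ :=
        hX.bdd_smul 1 ((hφm i).comp measurable_fst).aestronglyMeasurable
          (ae_of_all _ (hφn i))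
      rw [real_inner_comm, ← integral_inner hXi]
      simp_rw [real_inner_smul_right, real_inner_comm]
    simp_rw [hterm]
    refine le_trans ?_ (Finset.sum_le_sum fun i _ => le_inner_weighted_means hX hY
      ((hφm i).comp measurable_fst) (fun p => hφ0 i p.1) (fun p => hφle i p.1) hδ
      (fun p => hsupp i p.1) hq0 t (hint i))
    rw [Finset.sum_sub_distrib, ← Finset.mul_sum, ← Finset.mul_sum, Finset.sum_sub_distrib,
      ← Finset.mul_sum]
    have hS : ∑ i, ∫ p, φ i p.1 * (⟪p.1, p.2⟫ : ℝ) ∂γ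
        = ∫ p, (∑ i, φ i p.1) * (⟪p.1, p.2⟫ : ℝ) ∂γ := by
      rw [← integral_finsetSum _ fun i _ => hint i]
      simp_rw [Finset.sum_mul]
    simp only [Function.comp_apply]
    rw [hS]
    gcongr
    · exact hwle hY
    · exact hwle hX

/-- lower semicontinuity of `T(·,μ)` along weakly converging sequences of
centered probability measures. -/
theorem maxCorr_lsc {d : ℕ} (hd : 1 ≤ d)
    (μ : Measure (Ed d)) [IsProbabilityMeasure μ] (hμ1 : FirstMoment μ) (hμc : Centered μ)
    (ρs : ℕ → Measure (Ed d)) (ρ : Measure (Ed d))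
    [∀ n, IsProbabilityMeasure (ρs n)] [IsProbabilityMeasure ρ]
    (hρs1 : ∀ n, FirstMoment (ρs n)) (hρsc : ∀ n, Centered (ρs n))
    (hρ1 : FirstMoment ρ)
    (hconv : WeakConv ρs ρ) :
    maxCorr ρ μ ≤ liminf (fun n => maxCorr (ρs n) μ) atTop := by
  have hρs1' (n) : Integrable id (ρs n) :=
    (integrable_norm_iff aestronglyMeasurable_id).1 (hρs1 n)
  have hμ1' : Integrable id μ := (integrable_norm_iff aestronglyMeasurable_id).1 hμ1
  have hρ1' : Integrable id ρ := (integrable_norm_iff aestronglyMeasurable_id).1 hρ1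
  refine iSup₂_le fun γ hγ => ?_
  obtain ⟨hγp, hfst, hsnd⟩ := hγ
  have hX : Integrable Prod.fst γ := by
    subst hfst
    exact (integrable_map_measure aestronglyMeasurable_id measurable_fst.aemeasurable).1 hρ1'
  have hY : Integrable Prod.snd γ := by
    subst hsnd
    exact (integrable_map_measure aestronglyMeasurable_id measurable_snd.aemeasurable).1 hμ1'
  refine le_of_forall_lt_imp_le_of_dense fun c hc => ?_
  obtain ⟨a, hca, ha⟩ := EReal.lt_iff_exists_real_btwn.1 hc
  refine hca.le.trans ?_
  obtain ⟨a', haa', ha'⟩ := EReal.lt_iff_exists_real_btwn.1 ha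
  rw [EReal.coe_lt_coe_iff] at haa'
  have hδ (k : ℕ) : (0 : ℝ) < 1 / ((k : ℝ) + 1) := by positivity
  choose t φ hφ hφ0 hφ1 hφR hsupp using fun k : ℕ => exists_finite_partition (d := d) k (hδ k)
  have hφle (k i x) : φ k i x ≤ 1 :=
    (Finset.single_le_sum (fun j _ => hφ0 k j x) (Finset.mem_univ i)).trans (hφ1 k x)
  have hint (k i) : Integrable (fun p : Ed d × Ed d => φ k i p.1 * (⟪p.1, p.2⟫ : ℝ)) γ := by
    refine (hY.norm.const_mul (‖(i : Ed d)‖ + 1 / ((k : ℝ) + 1))).mono'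
      (((hφ k i).measurable.comp measurable_fst).mul (by fun_prop)).aestronglyMeasurable
      (ae_of_all _ fun p => ?_)
    exact abs_mul_inner_le (hφ0 k i) (hφle k i) (hδ k).le (hsupp k i) p.1 p.2
  let χ : ℕ → Ed d → ℝ := fun k x => ∑ i, φ k i x
  have hχ (k) : Measurable (χ k) := Finset.measurable_sum _ fun i _ => (hφ k i).measurable
  have hχ0 (k x) : 0 ≤ χ k x := Finset.sum_nonneg fun i _ => hφ0 k i x
  have hS := eventually_lt_integral_mul_inner ha' hχ hχ0 hφ1 hφR fun k => by
    simp only [χ, Finset.sum_mul]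
    exact integrable_finsetSum _ fun i _ => hint k i
  have hlim : Tendsto (fun k : ℕ => (∫ p, χ k p.1 ∂γ) *
        (a' - 2 * (1 / ((k : ℝ) + 1)) * ∫ p, ‖p.2‖ ∂γ)
      - ‖∫ p, (1 - χ k p.1) • p.2 ∂γ‖ * ∫ p, ‖p.1‖ ∂γ) atTop (𝓝 a') := by
    have := ((integral_cutoff_tendsto_one (γ := γ) hχ hχ0 hφ1 hφR).mul
      (tendsto_const_nhds (x := a').sub
        ((tendsto_one_div_add_atTop_nhds_zero_nat.const_mul 2).mul_const (∫ p, ‖p.2‖ ∂γ)))).sub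
      ((integral_one_sub_smul_tendsto_zero hY hχ hχ0 hφ1 hφR).norm.mul_const (∫ p, ‖p.1‖ ∂γ))
    simpa using this
  obtain ⟨k, hSk, hk⟩ := (hS.and (hlim.eventually_const_lt haa')).exists
  refine le_liminf_maxCorr_of_lt_discretized hμ1' hμc hρs1' hconv hfst hsnd hX hY (hφ k) (hφ0 k)
    (hφ1 k) (hδ k).le (hsupp k) (hint k) (hk.trans_le ?_)
  have hq0 : 0 ≤ ∫ p, χ k p.1 ∂γ := integral_nonneg fun p => hχ0 k p.1
  have := mul_le_mul_of_nonneg_left hSk.le hq0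
  simp only [χ] at this ⊢
  linarith
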